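/- Let (f_i)_{i∈I} be a family of proper lower semicontinuous convex functions from ℝⁿ to ℝ∪{+∞} such that the robust sum f := Σ^R_{i∈I} f_i is proper (dom f ≠ ∅), and let x̄* ∈ ℝⁿ satisfy x̄* ∈ ri co(⋃_{J∈𝓕(I)} Σ_{j∈J} dom f_j*) (the relative interior of the convex hull). Then the set of optimal solutions of the problem (RP_{x̄*}): inf_{x∈ℝⁿ} (f(x) − ⟨x̄*,x⟩) is the sum of a nonempty convex compact subset of ℝⁿ and a linear subspace of ℝⁿ. -/

import Mathlib

open scoped Pointwise Topology
open Set Matrix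

noncomputable section

variable {n : ℕ} {ι : Type*}

/-- Fenchel conjugate of `f : ℝⁿ → ℝ ∪ {+∞}` (modeled as `EReal`-valued). -/
def fconj (f : (Fin n → ℝ) → EReal) (p : Fin n → ℝ) : EReal :=
  ⨆ x : Fin n → ℝ, ((p ⬝ᵥ x : ℝ) : EReal) - f x

/-- Effective domain. -/
def fdom (f : (Fin n → ℝ) → EReal) : Set (Fin n → ℝ) := {x | f x ≠ ⊤}

/-- Domain of the conjugate. -/
def fdomStar (f : (Fin n → ℝ) → EReal) : Set (Fin n → ℝ) := {p | fconj f p ≠ ⊤}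

/-- Epigraph of the conjugate. -/
def fepiStar (f : (Fin n → ℝ) → EReal) : Set ((Fin n → ℝ) × ℝ) :=
  {q | fconj f q.1 ≤ (q.2 : EReal)}

/-- Proper function: never `-∞`, not identically `+∞`. -/
def EProper {X : Type*} (f : X → EReal) : Prop := (∀ x, f x ≠ ⊥) ∧ ∃ x, f x ≠ ⊤

/-- Convexity of an extended-real-valued function, via its epigraph. -/
def EConvexFn {X : Type*} [AddCommGroup X] [Module ℝ X] (f : X → EReal) : Prop :=
  Convex ℝ {q : X × ℝ | f q.1 ≤ (q.2 : EReal)}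

/-- Robust sum of a family of functions. -/
def rsum {X : Type*} (f : ι → X → EReal) (x : X) : EReal :=
  ⨆ (J : Finset ι) (_ : J.Nonempty), ∑ j ∈ J, f j x

/-- Optimal value of the primal problem `(RP_p)`. -/
def fprimalVal (f : (Fin n → ℝ) → EReal) (p : Fin n → ℝ) : EReal :=
  ⨅ x : Fin n → ℝ, f x - ((p ⬝ᵥ x : ℝ) : EReal)

/-- Optimal solution set of the primal problem `(RP_p)`. -/
def fprimalSol (f : (Fin n → ℝ) → EReal) (p : Fin n → ℝ) : Set (Fin n → ℝ) :=
  {x | f x - ((p ⬝ᵥ x : ℝ) : EReal) = fprimalVal f p}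

/-- Optimal value of the dual problem `(RD_p)`. -/
def fdualVal (f : ι → (Fin n → ℝ) → EReal) (p : Fin n → ℝ) : EReal :=
  ⨆ (J : Finset ι) (_ : J.Nonempty) (xs : ι → Fin n → ℝ) (_ : ∑ j ∈ J, xs j = p),
    -∑ j ∈ J, fconj (f j) (xs j)

section ExtendedReal

variable {X : Type*}

lemma EReal.coe_finset_sum_real (J : Finset ι) (a : ι → ℝ) :
    ((∑ j ∈ J, a j : ℝ) : EReal) = ∑ j ∈ J, (a j : EReal) :=
  map_sum (⟨⟨Real.toEReal, EReal.coe_zero⟩, EReal.coe_add⟩ : ℝ →+ EReal) a J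

lemma EReal.finset_sum_ne_bot {J : Finset ι} {a : ι → EReal} (h : ∀ j ∈ J, a j ≠ ⊥) :
    ∑ j ∈ J, a j ≠ ⊥ :=
  Finset.sum_induction a (· ≠ ⊥) (fun _ _ hx hy => EReal.add_ne_bot_iff.2 ⟨hx, hy⟩) (by simp) h

lemma EConvexFn.add [AddCommGroup X] [Module ℝ X] {f g : X → EReal} (hf : EConvexFn f)
    (hg : EConvexFn g) (hf' : ∀ x, f x ≠ ⊥) (hg' : ∀ x, g x ≠ ⊥) :
    EConvexFn fun x => f x + g x := by
  have split : ∀ x (r : ℝ), f x + g x ≤ r →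
      ∃ u w : ℝ, f x ≤ u ∧ g x ≤ w ∧ u + w ≤ r := by
    intro x r h
    have hfb := hf' x
    have hgb := hg' x
    generalize f x = a at *
    generalize g x = b at *
    induction a <;> induction b <;> simp_all
    exact ⟨_, le_rfl, _, le_rfl, by exact_mod_cast h⟩
  rintro ⟨x, r⟩ hx ⟨y, t⟩ hy a b ha hb hab
  obtain ⟨u, w, hu, hw, huw⟩ := split x r hx
  obtain ⟨u', w', hu', hw', huw'⟩ := split y t hy
  have h₁ : f (a • x + b • y) ≤ ((a * u + b * u' : ℝ) : EReal) :=
    hf (x := (x, u)) hu (y := (y, u')) hu' ha hb hab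
  have h₂ : g (a • x + b • y) ≤ ((a * w + b * w' : ℝ) : EReal) :=
    hg (x := (x, w)) hw (y := (y, w')) hw' ha hb hab
  change f (a • x + b • y) + g (a • x + b • y) ≤ ((a * r + b * t : ℝ) : EReal)
  refine (add_le_add h₁ h₂).trans ?_
  rw [← EReal.coe_add, EReal.coe_le_coe_iff]
  nlinarith

lemma EConvexFn.finset_sum [AddCommGroup X] [Module ℝ X] {f : ι → X → EReal}
    (hf : ∀ i, EConvexFn (f i)) (hf' : ∀ i x, f i x ≠ ⊥) (J : Finset ι) :
    EConvexFn fun x => ∑ j ∈ J, f j x := by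
  classical
  induction J using Finset.induction_on with
  | empty =>
    have : {q : X × ℝ | (0 : EReal) ≤ (q.2 : EReal)} = LinearMap.snd ℝ X ℝ ⁻¹' Ici 0 := by
      ext q
      simp
    simp only [EConvexFn, Finset.sum_empty, this]
    exact (convex_Ici (0 : ℝ)).linear_preimage (LinearMap.snd ℝ X ℝ)
  | insert i J hi ih =>
    simp only [Finset.sum_insert hi]
    exact (hf i).add ih (hf' i) fun x => EReal.finset_sum_ne_bot fun j _ => hf' j x

lemma LowerSemicontinuous.ereal_add [TopologicalSpace X] {f g : X → EReal}
    (hf : LowerSemicontinuous f) (hg : LowerSemicontinuous g) (hf' : ∀ x, f x ≠ ⊥)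
    (hg' : ∀ x, g x ≠ ⊥) : LowerSemicontinuous fun x => f x + g x :=
  hf.add' hg fun x => EReal.continuousAt_add (.inr (hg' x)) (.inl (hf' x))

lemma LowerSemicontinuous.ereal_finset_sum [TopologicalSpace X] {f : ι → X → EReal}
    (hf : ∀ i, LowerSemicontinuous (f i)) (hf' : ∀ i x, f i x ≠ ⊥) (J : Finset ι) :
    LowerSemicontinuous fun x => ∑ j ∈ J, f j x := by
  classical
  induction J using Finset.induction_on with
  | empty => simpa using lowerSemicontinuous_const
  | insert i J hi ih =>
    simp only [Finset.sum_insert hi]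
    exact (hf i).ereal_add ih (hf' i) fun x => EReal.finset_sum_ne_bot fun j _ => hf' j x

lemma sum_le_rsum (f : ι → X → EReal) {J : Finset ι} (hJ : J.Nonempty) (x : X) :
    ∑ j ∈ J, f j x ≤ rsum f x :=
  le_iSup₂ (f := fun (J : Finset ι) (_ : J.Nonempty) => ∑ j ∈ J, f j x) J hJ

lemma rsum_ne_bot [Nonempty ι] {f : ι → X → EReal} (hf : ∀ i x, f i x ≠ ⊥) (x : X) :
    rsum f x ≠ ⊥ := by
  obtain ⟨i⟩ := ‹Nonempty ι›
  have h := sum_le_rsum f (Finset.singleton_nonempty i) x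
  rw [Finset.sum_singleton] at h
  exact ne_bot_of_le_ne_bot (hf i x) h

lemma lowerSemicontinuous_rsum [TopologicalSpace X] {f : ι → X → EReal}
    (hf : ∀ i, LowerSemicontinuous (f i)) (hf' : ∀ i x, f i x ≠ ⊥) :
    LowerSemicontinuous (rsum f) :=
  lowerSemicontinuous_biSup fun J _ => LowerSemicontinuous.ereal_finset_sum hf hf' J

lemma EConvexFn.rsum [AddCommGroup X] [Module ℝ X] {f : ι → X → EReal}
    (hf : ∀ i, EConvexFn (f i)) (hf' : ∀ i x, f i x ≠ ⊥) : EConvexFn (rsum f) := by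
  have : {q : X × ℝ | _root_.rsum f q.1 ≤ (q.2 : EReal)} =
      ⋂ (J : Finset ι) (_ : J.Nonempty), {q : X × ℝ | ∑ j ∈ J, f j q.1 ≤ (q.2 : EReal)} := by
    ext q
    simp [_root_.rsum]
  rw [EConvexFn, this]
  exact convex_iInter₂ fun J _ => EConvexFn.finset_sum hf hf' J

end ExtendedReal

/-- The slopes of the affine minorants of `f`. -/
def affineMinorantSlopes (f : (Fin n → ℝ) → EReal) : Set (Fin n → ℝ) :=
  {q | ∃ M : ℝ, ∀ x, ((q ⬝ᵥ x - M : ℝ) : EReal) ≤ f x}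

lemma mem_affineMinorantSlopes_of_real {f : (Fin n → ℝ) → EReal} (hf : ∀ x, f x ≠ ⊥)
    {q : Fin n → ℝ} (M : ℝ) (h : ∀ x (r : ℝ), f x ≤ r → q ⬝ᵥ x ≤ r + M) :
    q ∈ affineMinorantSlopes f := by
  refine ⟨M, fun x => ?_⟩
  have hb := hf x
  have hx := h x
  generalize f x = a at *
  induction a
  · simp at hb
  · rename_i r
    rw [EReal.coe_le_coe_iff]
    linarith [hx r le_rfl]
  · simp

lemma fdomStar_eq_affineMinorantSlopes {f : (Fin n → ℝ) → EReal} (hf : ∀ x, f x ≠ ⊥) :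
    fdomStar f = affineMinorantSlopes f := by
  ext q
  constructor
  · intro hq
    obtain ⟨M, hM⟩ : ∃ M : ℝ, fconj f q ≤ M := by
      rw [fdomStar, mem_ofPred_eq] at hq
      generalize fconj f q = a at *
      induction a
      · exact ⟨0, bot_le⟩
      · exact ⟨_, le_rfl⟩
      · simp at hq
    refine mem_affineMinorantSlopes_of_real hf M fun x r hr => ?_
    have h := (EReal.sub_le_sub le_rfl hr).trans ((iSup_le_iff.1 hM) x)
    rw [← EReal.coe_sub, EReal.coe_le_coe_iff] at h
    linarith
  · rintro ⟨M, hM⟩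
    refine ne_top_of_le_ne_top (EReal.coe_ne_top M) (iSup_le fun x => ?_)
    refine (EReal.sub_le_sub le_rfl (hM x)).trans ?_
    rw [← EReal.coe_sub, EReal.coe_le_coe_iff]
    linarith

lemma convex_affineMinorantSlopes {f : (Fin n → ℝ) → EReal} (hf : ∀ x, f x ≠ ⊥) :
    Convex ℝ (affineMinorantSlopes f) := by
  rintro q ⟨M, hM⟩ q' ⟨M', hM'⟩ a b ha hb hab
  refine mem_affineMinorantSlopes_of_real hf (a * M + b * M') fun x r hr => ?_
  have h₁ := EReal.coe_le_coe_iff.1 ((hM x).trans hr)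
  have h₂ := EReal.coe_le_coe_iff.1 ((hM' x).trans hr)
  rw [add_dotProduct, smul_dotProduct, smul_dotProduct, smul_eq_mul, smul_eq_mul]
  have hr' : r = a * r + b * r := by rw [← add_mul, hab, one_mul]
  nlinarith

lemma sum_fdomStar_subset_affineMinorantSlopes_rsum {f : ι → (Fin n → ℝ) → EReal}
    (hf : ∀ i x, f i x ≠ ⊥) {J : Finset ι} (hJ : J.Nonempty) :
    ∑ j ∈ J, fdomStar (f j) ⊆ affineMinorantSlopes (rsum f) := by
  intro q hq
  obtain ⟨g, hg, rfl⟩ := (Set.mem_finsetSum _ _ _).1 hq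
  have : ∀ j, ∃ M : ℝ, j ∈ J → ∀ x, ((g j ⬝ᵥ x - M : ℝ) : EReal) ≤ f j x := by
    intro j
    by_cases hj : j ∈ J
    · have h := hg hj
      rw [fdomStar_eq_affineMinorantSlopes (hf j)] at h
      obtain ⟨M, hM⟩ := h
      exact ⟨M, fun _ => hM⟩
    · exact ⟨0, fun h => absurd h hj⟩
  choose M hM using this
  refine ⟨∑ j ∈ J, M j, fun x => le_trans ?_ (sum_le_rsum f hJ x)⟩
  rw [sum_dotProduct, ← Finset.sum_sub_distrib, EReal.coe_finset_sum_real]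
  exact Finset.sum_le_sum fun j hj => hM j hj x

lemma convexHull_subset_affineMinorantSlopes_rsum [Nonempty ι] {f : ι → (Fin n → ℝ) → EReal}
    (hf : ∀ i x, f i x ≠ ⊥) :
    convexHull ℝ (⋃ J ∈ {J : Finset ι | J.Nonempty}, ∑ j ∈ J, fdomStar (f j)) ⊆
      affineMinorantSlopes (rsum f) :=
  convexHull_min (iUnion₂_subset fun _ hJ => sum_fdomStar_subset_affineMinorantSlopes_rsum hf hJ)
    (convex_affineMinorantSlopes (rsum_ne_bot hf))

/-- Strict separation of a point from the epigraph of a lower semicontinuous convex function. -/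
lemma EConvexFn.exists_separation {f : (Fin n → ℝ) → EReal} (hlsc : LowerSemicontinuous f)
    (hconv : EConvexFn f) {y : Fin n → ℝ} {s : ℝ} (h : (s : EReal) < f y) :
    ∃ (q : Fin n → ℝ) (β u : ℝ), (∀ x (r : ℝ), f x ≤ r → q ⬝ᵥ x + β * r < u) ∧
      u < q ⬝ᵥ y + β * s := by
  have hclosed : IsClosed {q : (Fin n → ℝ) × ℝ | f q.1 ≤ (q.2 : EReal)} :=
    hlsc.isClosed_epigraph.preimage
      (continuous_fst.prodMk (continuous_coe_real_ereal.comp continuous_snd))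
  obtain ⟨φ, u, h₁, h₂⟩ := geometric_hahn_banach_closed_point hconv hclosed
    (x := (y, s)) (by simpa using h)
  obtain ⟨q, hq⟩ := (dotProductEquiv ℝ (Fin n)).surjective
    (φ.toLinearMap ∘ₗ LinearMap.inl ℝ (Fin n → ℝ) ℝ)
  have hφ : ∀ x r, φ (x, r) = q ⬝ᵥ x + φ (0, 1) * r := by
    intro x r
    have h₃ : q ⬝ᵥ x = φ (x, 0) := by simpa using LinearMap.congr_fun hq x
    have h₄ : ((x, r) : (Fin n → ℝ) × ℝ) = (x, 0) + r • (0, 1) := by simp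
    rw [h₄, map_add, map_smul, h₃, smul_eq_mul, mul_comm]
  refine ⟨q, φ (0, 1), u, fun x r hr => ?_, ?_⟩
  · rw [← hφ]
    exact h₁ (x, r) hr
  · rwa [← hφ]

/-- A separating functional of an epigraph has nonpositive last coordinate. -/
lemma nonpos_of_separation {f : (Fin n → ℝ) → EReal} {q : Fin n → ℝ} {β u : ℝ}
    (h : ∀ x (r : ℝ), f x ≤ r → q ⬝ᵥ x + β * r < u) {x : Fin n → ℝ} {r : ℝ}
    (hx : f x ≤ r) : β ≤ 0 := by
  by_contra! hβ
  have h₁ := h x (r + |u - q ⬝ᵥ x - β * r| / β)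
    (hx.trans (EReal.coe_le_coe_iff.2 (le_add_of_nonneg_right (by positivity))))
  rw [mul_add, mul_div_cancel₀ _ hβ.ne'] at h₁
  linarith [le_abs_self (u - q ⬝ᵥ x - β * r)]

/-- A separating functional with negative last coordinate yields an affine minorant. -/
lemma smul_mem_affineMinorantSlopes {f : (Fin n → ℝ) → EReal} (hf : ∀ x, f x ≠ ⊥)
    {q : Fin n → ℝ} {β u : ℝ} (h : ∀ x (r : ℝ), f x ≤ r → q ⬝ᵥ x + β * r < u) (hβ : β < 0) :
    (-β)⁻¹ • q ∈ affineMinorantSlopes f := by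
  refine mem_affineMinorantSlopes_of_real hf ((-β)⁻¹ * u) fun x r hr => ?_
  have hβ' : 0 < -β := by linarith
  rw [smul_dotProduct, smul_eq_mul, ← mul_le_mul_iff_right₀ hβ', mul_add,
    mul_inv_cancel_left₀ hβ'.ne', mul_inv_cancel_left₀ hβ'.ne']
  linarith [h x r hr]

lemma affineMinorantSlopes_nonempty {f : (Fin n → ℝ) → EReal} (hf : EProper f)
    (hlsc : LowerSemicontinuous f) (hconv : EConvexFn f) : (affineMinorantSlopes f).Nonempty := by
  obtain ⟨hb, x, hx⟩ := hf
  lift f x to ℝ using ⟨hx, hb x⟩ with r hr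
  have hlt : ((r - 1 : ℝ) : EReal) < f x := by
    rw [← hr, EReal.coe_lt_coe_iff]
    linarith
  obtain ⟨q, β, u, h, hu⟩ := hconv.exists_separation hlsc hlt
  have hβ : β < 0 := by linarith [h x r hr.ge]
  exact ⟨_, smul_mem_affineMinorantSlopes hb h hβ⟩

/-- If all slopes of affine minorants of `f` take the value `c` at `v`, then `f` grows at most
with slope `c` in the direction `v`. -/
lemma apply_add_le_of_slopes {f : (Fin n → ℝ) → EReal} (hf : EProper f)
    (hlsc : LowerSemicontinuous f) (hconv : EConvexFn f) {v : Fin n → ℝ} {c : ℝ}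
    (hv : ∀ q ∈ affineMinorantSlopes f, q ⬝ᵥ v = c) (x : Fin n → ℝ) :
    f (x + v) ≤ f x + (c : EReal) := by
  by_cases hx : f x = ⊤
  · simp [hx]
  have hb := hf.1
  obtain ⟨a, ha⟩ : ∃ a : ℝ, f x = a := ⟨_, (EReal.coe_toReal hx (hb x)).symm⟩
  by_contra! hlt
  rw [ha, ← EReal.coe_add] at hlt
  obtain ⟨q, β, u, h, hu⟩ := hconv.exists_separation hlsc hlt
  have hxa := h x a ha.le
  rw [dotProduct_add] at hu
  rcases (nonpos_of_separation h ha.le).lt_or_eq with hβ | rfl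
  · have hq := hv _ (smul_mem_affineMinorantSlopes hb h hβ)
    rw [smul_dotProduct, smul_eq_mul, inv_mul_eq_iff_eq_mul₀ (by linarith)] at hq
    linarith
  · obtain ⟨q₀, hq₀⟩ := affineMinorantSlopes_nonempty hf hlsc hconv
    have hq₁ : q₀ + q ∈ affineMinorantSlopes f := by
      obtain ⟨M, hM⟩ := hq₀
      refine mem_affineMinorantSlopes_of_real hb (M + u) fun y r hr => ?_
      have h₁ := EReal.coe_le_coe_iff.1 ((hM y).trans hr)
      rw [add_dotProduct]
      linarith [h y r hr]
    have h₁ := hv _ hq₀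
    have h₂ := hv _ hq₁
    rw [add_dotProduct] at h₂
    linarith

lemma fprimalSol_eq {F : (Fin n → ℝ) → EReal} {p x₀ : Fin n → ℝ} {m : ℝ}
    (hle : ∀ x, ((p ⬝ᵥ x + m : ℝ) : EReal) ≤ F x) (hx₀ : F x₀ ≤ ((p ⬝ᵥ x₀ + m : ℝ) : EReal)) :
    fprimalSol F p = {x | F x ≤ ((p ⬝ᵥ x + m : ℝ) : EReal)} := by
  have key : ∀ x, F x - ((p ⬝ᵥ x : ℝ) : EReal) ≤ m ↔ F x ≤ ((p ⬝ᵥ x + m : ℝ) : EReal) := by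
    intro x
    rw [EReal.sub_le_iff_le_add (by simp) (by simp), ← EReal.coe_add, add_comm m]
  have key' : ∀ x, (m : EReal) ≤ F x - ((p ⬝ᵥ x : ℝ) : EReal) := by
    intro x
    rw [EReal.le_sub_iff_add_le (by simp) (by simp), ← EReal.coe_add, add_comm m]
    exact hle x
  have hval : fprimalVal F p = m :=
    le_antisymm ((iInf_le _ x₀).trans ((key x₀).2 hx₀)) (le_iInf key')
  ext x
  rw [fprimalSol, mem_ofPred_eq, mem_ofPred_eq, hval, ← key]
  exact ⟨fun h => h.le, fun h => h.antisymm (key' x)⟩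

lemma EConvexFn.convex_sublevel {F : (Fin n → ℝ) → EReal} (hF : EConvexFn F) (p : Fin n → ℝ)
    (c : ℝ) : Convex ℝ {x | F x ≤ ((p ⬝ᵥ x + c : ℝ) : EReal)} := by
  intro x hx y hy a b ha hb hab
  have h : F (a • x + b • y) ≤ ((a * (p ⬝ᵥ x + c) + b * (p ⬝ᵥ y + c) : ℝ) : EReal) :=
    hF (x := (x, p ⬝ᵥ x + c)) hx (y := (y, p ⬝ᵥ y + c)) hy ha hb hab
  refine le_of_le_of_eq h ?_
  rw [EReal.coe_eq_coe_iff, dotProduct_add, dotProduct_smul, dotProduct_smul, smul_eq_mul,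
    smul_eq_mul]
  linear_combination c * hab

lemma isClosed_sublevel {F : (Fin n → ℝ) → EReal} (hF : LowerSemicontinuous F) (p : Fin n → ℝ)
    (c : ℝ) : IsClosed {x | F x ≤ ((p ⬝ᵥ x + c : ℝ) : EReal)} := by
  have hp : Continuous fun x : Fin n → ℝ => ((p ⬝ᵥ x + c : ℝ) : EReal) :=
    continuous_coe_real_ereal.comp ((continuous_const.dotProduct continuous_id).add
      continuous_const)
  exact hF.isClosed_epigraph.preimage (continuous_id.prodMk hp)

/-- The vectors orthogonal to `L` for the dot product. -/
def dotAnnihilator (L : Submodule ℝ (Fin n → ℝ)) : Submodule ℝ (Fin n → ℝ) where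
  carrier := {v | ∀ l ∈ L, l ⬝ᵥ v = 0}
  add_mem' hv hw l hl := by rw [dotProduct_add, hv l hl, hw l hl, add_zero]
  zero_mem' l _ := dotProduct_zero l
  smul_mem' a v hv l hl := by rw [dotProduct_smul, hv l hl, smul_zero]

/-- A subset of a complement of the annihilator of `L` on which every element of `L` is bounded
above is bounded. -/
lemma isBounded_of_dotProduct_le {L W : Submodule ℝ (Fin n → ℝ)}
    (hW : Disjoint (dotAnnihilator L) W) {S : Set (Fin n → ℝ)} (hSW : S ⊆ W)
    (hS : ∀ l ∈ L, ∃ B : ℝ, ∀ x ∈ S, l ⬝ᵥ x ≤ B) : Bornology.IsBounded S := by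
  let b := Module.finBasis ℝ L
  let Φ : W →ₗ[ℝ] (Fin (Module.finrank ℝ L) → ℝ) :=
    LinearMap.pi fun k => dotProductEquiv ℝ (Fin n) (b k : Fin n → ℝ) ∘ₗ W.subtype
  have hΦ : ∀ w k, Φ w k = (b k : Fin n → ℝ) ⬝ᵥ (w : Fin n → ℝ) := fun _ _ => rfl
  have hker : LinearMap.ker Φ = ⊥ := by
    refine LinearMap.ker_eq_bot'.2 fun w hw => ?_
    have hann : (w : Fin n → ℝ) ∈ dotAnnihilator L := by
      intro l hl
      have h₁ : (⟨l, hl⟩ : L) = ∑ k, b.repr ⟨l, hl⟩ k • b k := (b.sum_repr _).symm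
      have h₂ : l = ∑ k, b.repr ⟨l, hl⟩ k • (b k : Fin n → ℝ) := by
        simpa only [Submodule.coe_sum, Submodule.coe_smul] using congrArg Subtype.val h₁
      rw [h₂, sum_dotProduct]
      refine Finset.sum_eq_zero fun k _ => ?_
      rw [smul_dotProduct, ← hΦ, hw, Pi.zero_apply, smul_zero]
    exact Subtype.ext (Submodule.disjoint_def.1 hW _ hann w.2)
  obtain ⟨K, -, hK⟩ := Φ.exists_antilipschitzWith hker
  choose B hB using fun k => hS (b k) (b k).2
  choose B' hB' using fun k => hS (-(b k)) (neg_mem (b k).2)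
  have hbdd : Bornology.IsBounded (Φ ⁻¹' Icc (-B') B) :=
    hK.isBounded_preimage (Metric.isBounded_Icc _ _)
  have hsub : S ⊆ Subtype.val '' (Φ ⁻¹' Icc (-B') B) := by
    intro x hx
    refine ⟨⟨x, hSW hx⟩, ⟨fun k => ?_, fun k => ?_⟩, rfl⟩
    · have := hB' k x hx
      rw [neg_dotProduct] at this
      rw [hΦ, Pi.neg_apply]
      linarith
    · exact hB k x hx
  exact ((LipschitzWith.subtype_val (W : Set (Fin n → ℝ))).isBounded_image hbdd).subset hsub

/-- Structure of the solution set of a proper closed convex function tilted by `p` which is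
coercive along `L` and affine of slope `p` along the annihilator of `L`. -/
theorem exists_compact_add_submodule_of_coercive {F : (Fin n → ℝ) → EReal} {p : Fin n → ℝ}
    (hF : EProper F) (hlsc : LowerSemicontinuous F) (hconv : EConvexFn F)
    (L : Submodule ℝ (Fin n → ℝ))
    (hcoer : ∀ l ∈ L, ∀ c : ℝ, ∃ B : ℝ, ∀ x, F x ≤ ((p ⬝ᵥ x + c : ℝ) : EReal) → l ⬝ᵥ x ≤ B)
    (htrans : ∀ v ∈ dotAnnihilator L, ∀ x, F (x + v) ≤ F x + ((p ⬝ᵥ v : ℝ) : EReal)) :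
    ∃ (K : Set (Fin n → ℝ)) (V : Submodule ℝ (Fin n → ℝ)),
      K.Nonempty ∧ Convex ℝ K ∧ IsCompact K ∧ fprimalSol F p = K + (V : Set (Fin n → ℝ)) := by
  obtain ⟨W, hW⟩ := (dotAnnihilator L).exists_isCompl
  have hsub : ∀ c : ℝ, ∀ v ∈ dotAnnihilator L, ∀ x, F x ≤ ((p ⬝ᵥ x + c : ℝ) : EReal) →
      F (x + v) ≤ ((p ⬝ᵥ (x + v) + c : ℝ) : EReal) := by
    intro c v hv x hx
    refine (htrans v hv x).trans ((add_le_add_left hx _).trans ?_)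
    rw [← EReal.coe_add, EReal.coe_le_coe_iff, dotProduct_add]
    linarith
  have hdecomp : ∀ x, ∃ w ∈ W, ∃ v ∈ dotAnnihilator L, x = w + v := by
    intro x
    obtain ⟨v, hv, w, hw, h⟩ := Submodule.mem_sup.1 (hW.sup_eq_top.ge (Submodule.mem_top (x := x)))
    exact ⟨w, hw, v, hv, by rw [← h, add_comm]⟩
  have hcompact : ∀ c : ℝ, IsCompact ({x | F x ≤ ((p ⬝ᵥ x + c : ℝ) : EReal)} ∩ W) := by
    intro c
    refine Metric.isCompact_of_isClosed_isBounded
      ((isClosed_sublevel hlsc p c).inter W.closed_of_finiteDimensional) ?_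
    refine isBounded_of_dotProduct_le hW.disjoint inter_subset_right fun l hl => ?_
    obtain ⟨B, hB⟩ := hcoer l hl c
    exact ⟨B, fun x hx => hB x hx.1⟩
  have hproj : ∀ c : ℝ, ∀ x, F x ≤ ((p ⬝ᵥ x + c : ℝ) : EReal) →
      ∃ w ∈ {x | F x ≤ ((p ⬝ᵥ x + c : ℝ) : EReal)} ∩ (W : Set (Fin n → ℝ)),
        ∃ v ∈ dotAnnihilator L, w + v = x := by
    intro c x hx
    obtain ⟨w, hw, v, hv, rfl⟩ := hdecomp x
    refine ⟨w, ⟨?_, hw⟩, v, hv, rfl⟩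
    simpa using hsub c (-v) (neg_mem hv) _ hx
  have hreal : ∀ x, F x ≠ ⊤ → ∃ c : ℝ, F x = ((p ⬝ᵥ x + c : ℝ) : EReal) := by
    intro x hx
    refine ⟨(F x).toReal - p ⬝ᵥ x, ?_⟩
    rw [add_sub_cancel, EReal.coe_toReal hx (hF.1 x)]
  obtain ⟨x₁, hx₁⟩ := hF.2
  obtain ⟨c₁, hc₁⟩ := hreal x₁ hx₁
  obtain ⟨w₁, hw₁, -⟩ := hproj c₁ x₁ hc₁.le
  have hg : LowerSemicontinuous fun x => F x + ((-(p ⬝ᵥ x) : ℝ) : EReal) := by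
    refine hlsc.ereal_add (Continuous.lowerSemicontinuous ?_) hF.1 fun x => EReal.coe_ne_bot _
    exact continuous_coe_real_ereal.comp (continuous_const.dotProduct continuous_id).neg
  obtain ⟨x₀, hx₀, hmin⟩ :=
    LowerSemicontinuousOn.exists_isMinOn ⟨w₁, hw₁⟩ (hcompact c₁) (hg.lowerSemicontinuousOn _)
  obtain ⟨m, hm⟩ := hreal x₀ (ne_top_of_le_ne_top (EReal.coe_ne_top _) hx₀.1)
  have hmc : m ≤ c₁ := by
    have := hx₀.1
    rw [mem_ofPred_eq, hm, EReal.coe_le_coe_iff] at this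
    linarith
  have hle : ∀ x, ((p ⬝ᵥ x + m : ℝ) : EReal) ≤ F x := by
    intro x
    by_contra! hlt
    obtain ⟨c, hc⟩ := hreal x hlt.ne_top
    rw [hc, EReal.coe_lt_coe_iff] at hlt
    obtain ⟨w, ⟨hw, hwW⟩, -⟩ := hproj c x hc.le
    rw [mem_ofPred_eq] at hw
    have hw' : F w ≤ ((p ⬝ᵥ w + c₁ : ℝ) : EReal) :=
      hw.trans (EReal.coe_le_coe_iff.2 (by linarith))
    have h := (isMinOn_iff.1 hmin w ⟨hw', hwW⟩).trans (add_le_add_left hw _)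
    rw [hm, ← EReal.coe_add, ← EReal.coe_add, EReal.coe_le_coe_iff] at h
    linarith
  refine ⟨{x | F x ≤ ((p ⬝ᵥ x + m : ℝ) : EReal)} ∩ W, dotAnnihilator L, ⟨x₀, hm.le, hx₀.2⟩,
    (hconv.convex_sublevel p m).inter W.convex, hcompact m, ?_⟩
  rw [fprimalSol_eq hle hm.le]
  ext x
  constructor
  · intro hx
    obtain ⟨w, hw, v, hv, rfl⟩ := hproj m x hx
    exact add_mem_add hw hv
  · rintro ⟨w, hw, v, hv, rfl⟩
    exact hsub m v hv w hw.1

/-- A point of the intrinsic interior can be moved a little in every direction of the affine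
span. -/
lemma exists_pos_add_smul_mem_of_mem_intrinsicInterior {E : Type*} [NormedAddCommGroup E]
    [NormedSpace ℝ E] {C : Set E} {p l : E} (hp : p ∈ intrinsicInterior ℝ C)
    (hl : l ∈ (affineSpan ℝ C).direction) : ∃ t : ℝ, 0 < t ∧ p + t • l ∈ C := by
  obtain ⟨y, hy, rfl⟩ := hp
  let γ : ℝ → affineSpan ℝ C := fun t =>
    ⟨(y : E) + t • l, by
      rw [add_comm]
      exact AffineSubspace.vadd_mem_of_mem_direction (Submodule.smul_mem _ t hl) y.2⟩
  have hγ : Continuous γ := by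
    refine Continuous.subtype_mk ?_ _
    fun_prop
  have hγ0 : γ 0 = y := Subtype.ext (by simp [γ])
  have hmem : ∀ᶠ t in 𝓝 (0 : ℝ), γ t ∈ ((↑) ⁻¹' C : Set (affineSpan ℝ C)) := by
    refine hγ.continuousAt.eventually_mem ?_
    rw [hγ0]
    exact mem_interior_iff_mem_nhds.1 hy
  obtain ⟨t, ht, htpos⟩ :=
    ((hmem.filter_mono nhdsWithin_le_nhds).and (self_mem_nhdsWithin (s := Ioi (0 : ℝ)))).exists
  exact ⟨t, htpos, ht⟩

/-- If all elements of the sums of the conjugate domains take the value `c` at `v`, the robust sum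
grows at most with slope `c` in the direction `v`. -/
lemma rsum_apply_add_le {f : ι → (Fin n → ℝ) → EReal} (hproper : ∀ i, EProper (f i))
    (hlsc : ∀ i, LowerSemicontinuous (f i)) (hconv : ∀ i, EConvexFn (f i)) {v : Fin n → ℝ} {c : ℝ}
    (hv : ∀ J : Finset ι, J.Nonempty → ∀ q ∈ ∑ j ∈ J, fdomStar (f j), q ⬝ᵥ v = c)
    (x : Fin n → ℝ) : rsum f (x + v) ≤ rsum f x + (c : EReal) := by
  have hdom : ∀ i, fdomStar (f i) = affineMinorantSlopes (f i) := fun i =>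
    fdomStar_eq_affineMinorantSlopes (hproper i).1
  have hstep : ∀ i, f i (x + v) ≤ f i x + (c : EReal) := by
    intro i
    refine apply_add_le_of_slopes (hproper i) (hlsc i) (hconv i) (fun q hq => ?_) x
    refine hv {i} (Finset.singleton_nonempty i) q ?_
    rwa [Finset.sum_singleton, hdom i]
  choose g hg using fun i => affineMinorantSlopes_nonempty (hproper i) (hlsc i) (hconv i)
  have hgv : ∀ i, g i ⬝ᵥ v = c := fun i =>
    hv {i} (Finset.singleton_nonempty i) _ (by rw [Finset.sum_singleton, hdom i]; exact hg i)
  refine iSup₂_le fun J hJ => ?_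
  have hsum : ∑ _j ∈ J, c = c := by
    have h := hv J hJ (∑ j ∈ J, g j)
      ((Set.mem_finsetSum _ _ _).2 ⟨g, fun {i} _ => by rw [hdom i]; exact hg i, rfl⟩)
    rw [sum_dotProduct] at h
    exact (Finset.sum_congr rfl fun i _ => (hgv i).symm).trans h
  calc ∑ j ∈ J, f j (x + v) ≤ ∑ j ∈ J, (f j x + (c : EReal)) :=
        Finset.sum_le_sum fun j _ => hstep j
    _ = ∑ j ∈ J, f j x + (c : EReal) := by
        rw [Finset.sum_add_distrib, ← EReal.coe_finset_sum_real, hsum]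
    _ ≤ rsum f x + (c : EReal) := add_le_add_left (sum_le_rsum f hJ x) _

/-- **Corollary 3.2 (Corollary 2.1).** Let `(f i)_{i ∈ ι} ⊆ Γ(ℝⁿ)` with `dom f ≠ ∅` (where `f`
is the robust sum), and `x̄* ∈ ri co (⋃_{J ∈ 𝓕(ι)} Σ_{j ∈ J} dom f_j*)`. Then `sol(RP_{x̄*})`
is the sum of a nonempty convex compact set and a linear subspace of `ℝⁿ`. -/
theorem primal_solutions_existence_fin [Nonempty ι]
    (f : ι → (Fin n → ℝ) → EReal) (p : Fin n → ℝ)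
    (hproper : ∀ i, EProper (f i)) (hlsc : ∀ i, LowerSemicontinuous (f i))
    (hconv : ∀ i, EConvexFn (f i))
    (hdom : ∃ x, rsum f x ≠ ⊤)
    (hri : p ∈ intrinsicInterior ℝ (convexHull ℝ
      (⋃ J ∈ {J : Finset ι | J.Nonempty}, ∑ j ∈ J, fdomStar (f j)))) :
    ∃ (K : Set (Fin n → ℝ)) (V : Submodule ℝ (Fin n → ℝ)),
      K.Nonempty ∧ Convex ℝ K ∧ IsCompact K ∧
      fprimalSol (rsum f) p = K + (V : Set (Fin n → ℝ)) := by
  have hb : ∀ i x, f i x ≠ ⊥ := fun i => (hproper i).1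
  set A := ⋃ J ∈ {J : Finset ι | J.Nonempty}, ∑ j ∈ J, fdomStar (f j)
  have hpspan : p ∈ affineSpan ℝ (convexHull ℝ A) :=
    subset_affineSpan ℝ _ (intrinsicInterior_subset hri)
  refine exists_compact_add_submodule_of_coercive ⟨rsum_ne_bot hb, hdom⟩
    (lowerSemicontinuous_rsum hlsc hb) (EConvexFn.rsum hconv hb)
    (affineSpan ℝ (convexHull ℝ A)).direction ?_ ?_
  · intro l hl c
    obtain ⟨t, ht, htl⟩ := exists_pos_add_smul_mem_of_mem_intrinsicInterior hri hl
    obtain ⟨M, hM⟩ := convexHull_subset_affineMinorantSlopes_rsum hb htl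
    refine ⟨(c + M) / t, fun x hx => ?_⟩
    have h := EReal.coe_le_coe_iff.1 ((hM x).trans hx)
    rw [add_dotProduct, smul_dotProduct, smul_eq_mul] at h
    rw [le_div_iff₀ ht]
    linarith
  · intro v hv
    refine rsum_apply_add_le hproper hlsc hconv fun J hJ q hq => ?_
    have hqA : q ∈ affineSpan ℝ (convexHull ℝ A) :=
      subset_affineSpan ℝ _ (subset_convexHull ℝ A
        (mem_biUnion (show J ∈ {J : Finset ι | J.Nonempty} from hJ) hq))
    have h := hv _ (AffineSubspace.vsub_mem_direction hqA hpspan)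
    rw [vsub_eq_sub, sub_dotProduct] at h
    linarith
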